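/- Let n ≥ 3, let Q = I − (1/n)·w w* where w = Σ_{i=1}^n e_i⊗e_i ∈ ℂⁿ⊗ℂⁿ, and set m = n² − 1. Suppose {u_1,…,u_m} is an orthonormal basis of the range of Q, a_1,…,a_N, b_1,…,b_N ∈ ℂⁿ satisfy Σ_{i=1}^N a_i a_i* ⊗ \bar{b_i} b_iᵀ = I, and S_1 ∪ ⋯ ∪ S_m = {1,…,N} is a pairwise-disjoint partition with u_k* (Σ_{i∈S_l} a_i a_i* ⊗ \bar{b_i} b_iᵀ) u_k = δ_{kl} for all 1 ≤ k,l ≤ m. Then the operators Q (a_i a_i* ⊗ \bar{b_i} b_iᵀ) Q and Q (a_j a_j* ⊗ \bar{b_j} b_jᵀ) Q commute for every choice of i and j in {1,…,N}. -/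

import Mathlib

open Matrix Kronecker BigOperators

noncomputable section

/-- The (unnormalized) canonical maximally entangled vector `w = ∑ e_i ⊗ e_i`. -/
def maxEnt (n : ℕ) : Fin n × Fin n → ℂ := fun p => if p.1 = p.2 then 1 else 0

/-- The orthogonal projection `Q = I - (1/n) w w*` onto the orthogonal complement of `w`. -/
def Qproj (n : ℕ) : Matrix (Fin n × Fin n) (Fin n × Fin n) ℂ :=
  1 - (1 / (n : ℂ)) • Matrix.vecMulVec (maxEnt n) (star (maxEnt n))

/-- The measurement operator `a a* ⊗ conj(b) bᵀ` on `ℂⁿ ⊗ ℂⁿ ≅ ℂ^{n²}`. -/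
def meas {n : ℕ} (a b : Fin n → ℂ) : Matrix (Fin n × Fin n) (Fin n × Fin n) ℂ :=
  Matrix.vecMulVec a (star a) ⊗ₖ Matrix.vecMulVec (star b) b

lemma aux_meas {n : ℕ} (a b : Fin n → ℂ) : ∃ v : Fin n × Fin n → ℂ,
    meas a b = Matrix.vecMulVec v (star v) := by
  refine ⟨fun p => a p.1 * star (b p.2), ?_⟩
  ext ⟨p, q⟩ ⟨r, s⟩
  simp [meas, Matrix.vecMulVec_apply]
  ring

lemma aux_ww {n : ℕ} : star (maxEnt n) ⬝ᵥ maxEnt n = (n : ℂ) := by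
  simp [dotProduct, maxEnt, Fintype.sum_prod_type]

lemma aux_conj {ι : Type*} [Fintype ι] (x y : ι → ℂ) :
    star x ⬝ᵥ y = star (star y ⬝ᵥ x) := by
  rw [Matrix.star_dotProduct]

lemma aux_quad {ι : Type*} [Fintype ι] (u v : ι → ℂ) :
    star u ⬝ᵥ (Matrix.vecMulVec v (star v) *ᵥ u)
      = ((Complex.normSq (star u ⬝ᵥ v) : ℝ) : ℂ) := by
  rw [Matrix.vecMulVec_mulVec, Complex.normSq_eq_conj_mul_self, aux_conj v u]
  simp [mul_comm]

lemma aux_perp (n : ℕ) (hn : 3 ≤ n) (x : Fin n × Fin n → ℂ) (hx : Qproj n *ᵥ x = x) :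
    star (maxEnt n) ⬝ᵥ x = 0 := by
  have hn0 : (n : ℂ) ≠ 0 := by
    have : n ≠ 0 := by omega
    exact_mod_cast this
  have h := congrArg (fun y => star (maxEnt n) ⬝ᵥ y) hx
  simp only [Qproj, Matrix.sub_mulVec, Matrix.one_mulVec, Matrix.smul_mulVec,
    Matrix.vecMulVec_mulVec, dotProduct_sub, dotProduct_smul] at h
  simp only [aux_ww, smul_eq_mul, MulOpposite.smul_eq_mul_unop, MulOpposite.unop_op] at h
  field_simp at h
  simpa using h.symm

lemma aux_Q (n : ℕ) (hn : 3 ≤ n)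
    (u : Fin (n ^ 2 - 1) → (Fin n × Fin n → ℂ))
    (horth : ∀ k l, star (u k) ⬝ᵥ u l = if k = l then (1 : ℂ) else 0)
    (hrange : ∀ k, Qproj n *ᵥ u k = u k) :
    Qproj n = ∑ k, Matrix.vecMulVec (u k) (star (u k)) := by
  have hn0 : (n : ℂ) ≠ 0 := by
    have : n ≠ 0 := by omega
    exact_mod_cast this
  let A : Matrix (Option (Fin (n ^ 2 - 1))) (Fin n × Fin n) ℂ :=
    Matrix.of (fun k p => k.elim ((1 / (n : ℂ)) * star (maxEnt n p)) (fun k => star (u k p)))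
  let B : Matrix (Fin n × Fin n) (Option (Fin (n ^ 2 - 1))) ℂ :=
    Matrix.of (fun p k => k.elim (maxEnt n p) (fun k => u k p))
  have hp := fun k => aux_perp n hn (u k) (hrange k)
  have hp' : ∀ k, star (u k) ⬝ᵥ maxEnt n = 0 := fun k => by rw [aux_conj, hp k, star_zero]
  have hAB : A * B = 1 := by
    ext k l
    rcases k with _ | k <;> rcases l with _ | l
    · have := aux_ww (n := n)
      simp only [dotProduct, Pi.star_apply] at this
      rw [Matrix.mul_apply]; simp only [A, B, Matrix.of_apply, Option.elim, mul_assoc, ← Finset.mul_sum, this]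
      simp [hn0]
    · have := hp l
      simp only [dotProduct, Pi.star_apply] at this
      rw [Matrix.mul_apply]; simp only [A, B, Matrix.of_apply, Option.elim, mul_assoc, ← Finset.mul_sum, this]
      simp
    · have := hp' k
      simp only [dotProduct, Pi.star_apply] at this
      rw [Matrix.mul_apply]; simp only [A, B, Matrix.of_apply, Option.elim, this]
      simp
    · have := horth k l
      simp only [dotProduct, Pi.star_apply] at this
      rw [Matrix.mul_apply]; simp only [A, B, Matrix.of_apply, Option.elim, this]
      simp [Matrix.one_apply]
  have hcard : Fintype.card (Option (Fin (n ^ 2 - 1))) = Fintype.card (Fin n × Fin n) := by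
    have : 0 < n ^ 2 := by positivity
    simp only [Fintype.card_option, Fintype.card_fin, Fintype.card_prod]
    rw [← pow_two]; omega
  have hBA : B * A = 1 := (Matrix.mul_eq_one_comm_of_card_eq (R := ℂ) _ _ hcard).1 hAB
  rw [Qproj, sub_eq_iff_eq_add, ← hBA]
  ext p q
  rw [Matrix.mul_apply, Fintype.sum_option]; simp only [A, B, Matrix.of_apply, Option.elim, Matrix.add_apply,
    Matrix.sum_apply, Matrix.smul_apply, Matrix.vecMulVec_apply, smul_eq_mul, Pi.star_apply]
  ring

theorem stmt10 (n N : ℕ) (hn : 3 ≤ n)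
    (u : Fin (n ^ 2 - 1) → (Fin n × Fin n → ℂ))
    (horth : ∀ k l, star (u k) ⬝ᵥ u l = if k = l then (1 : ℂ) else 0)
    (hrange : ∀ k, Qproj n *ᵥ u k = u k)
    (a b : Fin N → (Fin n → ℂ))
    (hsum : ∑ i, meas (a i) (b i) = (1 : Matrix (Fin n × Fin n) (Fin n × Fin n) ℂ))
    (S : Fin (n ^ 2 - 1) → Finset (Fin N))
    (hdisj : ∀ k l, k ≠ l → Disjoint (S k) (S l))
    (hcover : ∀ i : Fin N, ∃ k, i ∈ S k)
    (hdist : ∀ k l, star (u k) ⬝ᵥ ((∑ i ∈ S l, meas (a i) (b i)) *ᵥ u k)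
        = if k = l then (1 : ℂ) else 0) :
    ∀ i j : Fin N,
      (Qproj n * meas (a i) (b i) * Qproj n) * (Qproj n * meas (a j) (b j) * Qproj n)
        = (Qproj n * meas (a j) (b j) * Qproj n) * (Qproj n * meas (a i) (b i) * Qproj n) := by
  have hQ := aux_Q n hn u horth hrange
  have hQH : (Qproj n)ᴴ = Qproj n := by
    rw [hQ, Matrix.conjTranspose_sum]
    simp [Matrix.conjTranspose_vecMulVec]
  have key : ∀ i, ∃ (l : Fin (n ^ 2 - 1)) (c : ℂ),
      Qproj n * meas (a i) (b i) * Qproj n = c • Matrix.vecMulVec (u l) (star (u l)) := by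
    intro i
    obtain ⟨l, hl⟩ := hcover i
    choose v hv using fun i => aux_meas (a i) (b i)
    have hz : ∀ k, k ≠ l → star (u k) ⬝ᵥ v i = 0 := by
      intro k hk
      have h := hdist k l
      simp only [Matrix.sum_mulVec, dotProduct_sum, hv, aux_quad, if_neg hk] at h
      have h2 : ∑ i ∈ S l, Complex.normSq (star (u k) ⬝ᵥ v i) = 0 := by exact_mod_cast h
      exact Complex.normSq_eq_zero.1
        ((Finset.sum_eq_zero_iff_of_nonneg (fun _ _ => Complex.normSq_nonneg _)).1 h2 i hl)
    have hQv : Qproj n *ᵥ v i = (star (u l) ⬝ᵥ v i) • u l := by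
      rw [hQ, Matrix.sum_mulVec, Finset.sum_eq_single l]
      · rw [Matrix.vecMulVec_mulVec]; ext; simp [mul_comm]
      · intro k _ hk
        rw [Matrix.vecMulVec_mulVec, hz k hk]; simp
      · simp
    have hQv' : star (v i) ᵥ* Qproj n = star (Qproj n *ᵥ v i) := by
      rw [Matrix.star_mulVec, hQH]
    refine ⟨l, (star (u l) ⬝ᵥ v i) * star (star (u l) ⬝ᵥ v i), ?_⟩
    rw [hv, Matrix.mul_vecMulVec, Matrix.vecMulVec_mul, hQv', hQv]
    ext p q
    simp only [Matrix.smul_apply, Matrix.vecMulVec_apply, smul_eq_mul, Pi.star_apply,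
      Pi.smul_apply, star_mul']
    ring
  intro i j
  obtain ⟨k, c, hk⟩ := key i
  obtain ⟨l, d, hl⟩ := key j
  rw [hk, hl]
  simp only [Matrix.smul_mul, Matrix.mul_smul, Matrix.vecMulVec_mul_vecMulVec, horth]
  by_cases h : k = l
  · subst h
    rw [smul_comm]
  · simp [h, Ne.symm h]
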